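/- Let d ∈ {2, 3} and γ ∈ (0, d/2). For any q ∈ (0, min{1, 1/(d−2γ)}) there is a constant C = C(d, γ, q) > 0 such that D_N ≤ C ε_N^q for all N ≥ 1. -/

import Mathlib

/-- Euclidean norm of a lattice point `k ∈ ℤ^d`. -/
noncomputable def znorm {d : ℕ} (k : Fin d → ℤ) : ℝ :=
  Real.sqrt (∑ i, ((k i : ℝ)) ^ 2)

/-- `ε_N = (∑_{k ∈ ℤ^d₀, |k| ≤ N} |k|^{-2γ})⁻¹`. -/
noncomputable def epsN (d : ℕ) (γ : ℝ) (N : ℕ) : ℝ :=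
  (∑' k : Fin d → ℤ, if k ≠ 0 ∧ znorm k ≤ N then znorm k ^ (-(2 : ℝ) * γ) else 0)⁻¹

/-- `D_N = ε_N ∑_{k ∈ ℤ^d₀, |k| ≤ N} |k|^{-2γ-1}`. -/
noncomputable def DN (d : ℕ) (γ : ℝ) (N : ℕ) : ℝ :=
  epsN d γ N *
    ∑' k : Fin d → ℤ, if k ≠ 0 ∧ znorm k ≤ N then znorm k ^ (-(2 : ℝ) * γ - 1) else 0

theorem znorm_nonneg {d : ℕ} (k : Fin d → ℤ) : 0 ≤ znorm k :=
  Real.sqrt_nonneg _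

theorem abs_apply_le_znorm {d : ℕ} (k : Fin d → ℤ) (i : Fin d) : |(k i : ℝ)| ≤ znorm k := by
  rw [← Real.sqrt_sq_eq_abs]
  exact Real.sqrt_le_sqrt
    (Finset.single_le_sum (f := fun i => ((k i : ℝ)) ^ 2) (fun _ _ => sq_nonneg _)
      (Finset.mem_univ i))

theorem one_le_znorm {d : ℕ} {k : Fin d → ℤ} (hk : k ≠ 0) : 1 ≤ znorm k := by
  obtain ⟨i, hi⟩ := Function.ne_iff.mp hk
  refine le_trans ?_ (abs_apply_le_znorm k i)
  exact_mod_cast Int.one_le_abs hi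

theorem znorm_le_mul {d : ℕ} {k : Fin d → ℤ} {m : ℝ} (hm : 0 ≤ m)
    (h : ∀ i, |(k i : ℝ)| ≤ m) : znorm k ≤ d * m := by
  refine Real.sqrt_le_iff.mpr ⟨by positivity, ?_⟩
  have hsum : ∑ i, ((k i : ℝ)) ^ 2 ≤ d * m ^ 2 := by
    calc ∑ i, ((k i : ℝ)) ^ 2 ≤ ∑ _i : Fin d, m ^ 2 :=
          Finset.sum_le_sum fun i _ => sq_le_sq.mpr ((h i).trans (le_abs_self m))
      _ = d * m ^ 2 := by simp
  have hd : (d : ℝ) ≤ (d : ℝ) ^ 2 := by exact_mod_cast Nat.le_self_pow two_ne_zero d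
  nlinarith [sq_nonneg m]

theorem znorm_single {d : ℕ} (i : Fin d) : znorm (Pi.single i (1 : ℤ)) = 1 := by
  simp [znorm, Pi.single_apply]

theorem summable_znorm_rpow {d : ℕ} {r : ℝ} (hr : r < -(d : ℝ)) :
    Summable fun k : Fin d → ℤ => znorm k ^ r := by
  let b := (EuclideanSpace.basisFun (Fin d) ℝ).toBasis
  let e := (b.restrictScalars ℤ).equivFun
  have hrank : Module.finrank ℤ (Submodule.span ℤ (Set.range b)) = d := by
    simpa using Module.finrank_eq_card_basis (b.restrictScalars ℤ)
  have hs := ZLattice.summable_norm_rpow (Submodule.span ℤ (Set.range b)) r (by rwa [hrank])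
  refine (hs.comp_injective e.symm.injective).congr fun k => ?_
  have hk : ‖e.symm k‖ = znorm k := by
    have hcoe : (e.symm k : EuclideanSpace ℝ (Fin d)) = ∑ j, k j • b j := by
      rw [Module.Basis.equivFun_symm_apply, Submodule.coe_sum]
      simp
    rw [Submodule.coe_norm, hcoe, EuclideanSpace.norm_eq, znorm]
    congr 1
    refine Finset.sum_congr rfl fun i _ => ?_
    simp [b, Pi.single_apply]
  exact congrArg (· ^ r) hk

theorem truncated_rpow_nonneg {d : ℕ} (r R : ℝ) (k : Fin d → ℤ) :
    0 ≤ if k ≠ 0 ∧ znorm k ≤ R then znorm k ^ r else 0 := by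
  split_ifs
  exacts [Real.rpow_nonneg (znorm_nonneg k) r, le_rfl]

theorem truncated_rpow_le {d : ℕ} {r s R : ℝ} (hsr : s ≤ r) (hR : 0 ≤ R) (k : Fin d → ℤ) :
    (if k ≠ 0 ∧ znorm k ≤ R then znorm k ^ r else 0) ≤ R ^ (r - s) * znorm k ^ s := by
  split_ifs with h
  · have hpos : 0 < znorm k := one_pos.trans_le (one_le_znorm h.1)
    calc znorm k ^ r = znorm k ^ (r - s) * znorm k ^ s := by
          rw [← Real.rpow_add hpos, sub_add_cancel]
      _ ≤ R ^ (r - s) * znorm k ^ s := by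
          gcongr
          exact h.2
  · exact mul_nonneg (Real.rpow_nonneg hR _) (Real.rpow_nonneg (znorm_nonneg k) _)

theorem summable_truncated_rpow {d : ℕ} (r : ℝ) {R : ℝ} (hR : 0 ≤ R) :
    Summable fun k : Fin d → ℤ => if k ≠ 0 ∧ znorm k ≤ R then znorm k ^ r else 0 :=
  Summable.of_nonneg_of_le (truncated_rpow_nonneg r R)
    (truncated_rpow_le (s := min r (-(d : ℝ) - 1)) (min_le_left _ _) hR)
    ((summable_znorm_rpow ((min_le_right _ _).trans_lt (by linarith))).mul_left _)

theorem tsum_truncated_rpow_le {d : ℕ} {r s R : ℝ} (hsr : s ≤ r) (hs : s < -(d : ℝ))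
    (hR : 0 ≤ R) :
    ∑' k : Fin d → ℤ, (if k ≠ 0 ∧ znorm k ≤ R then znorm k ^ r else 0) ≤
      R ^ (r - s) * ∑' k : Fin d → ℤ, znorm k ^ s := by
  rw [← tsum_mul_left]
  exact (summable_truncated_rpow r hR).tsum_le_tsum (truncated_rpow_le hsr hR)
    ((summable_znorm_rpow hs).mul_left _)

theorem one_le_tsum_truncated_rpow {d : ℕ} (hd : d ≠ 0) (r : ℝ) {R : ℝ} (hR : 1 ≤ R) :
    1 ≤ ∑' k : Fin d → ℤ, if k ≠ 0 ∧ znorm k ≤ R then znorm k ^ r else 0 := by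
  let i : Fin d := ⟨0, Nat.pos_of_ne_zero hd⟩
  have h := (summable_truncated_rpow (d := d) r (zero_le_one.trans hR)).le_tsum (Pi.single i 1)
    fun k _ => truncated_rpow_nonneg r R k
  simpa [znorm_single, hR] using h

/-- Lower bound by the contribution of the box `[1, m]^d`, all of whose points have norm at most
`d * m`. -/
theorem pow_mul_rpow_le_tsum_truncated_rpow {d m : ℕ} (hd : d ≠ 0) {r R : ℝ} (hr : r ≤ 0)
    (hR : 0 ≤ R) (hm : (d : ℝ) * m ≤ R) :
    (m : ℝ) ^ d * R ^ r ≤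
      ∑' k : Fin d → ℤ, if k ≠ 0 ∧ znorm k ≤ R then znorm k ^ r else 0 := by
  let s : Finset (Fin d → ℤ) := Fintype.piFinset fun _ => Finset.Icc 1 (m : ℤ)
  have hcard : (s.card : ℝ) = (m : ℝ) ^ d := by simp [s]
  calc (m : ℝ) ^ d * R ^ r = s.card • R ^ r := by rw [nsmul_eq_mul, hcard]
    _ ≤ ∑ k ∈ s, if k ≠ 0 ∧ znorm k ≤ R then znorm k ^ r else 0 := by
        refine Finset.card_nsmul_le_sum _ _ _ fun k hk => ?_
        have hk' : ∀ i, 1 ≤ k i ∧ k i ≤ m := by simpa [s] using hk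
        have hk0 : k ≠ 0 := by
          rintro rfl
          simpa using (hk' ⟨0, Nat.pos_of_ne_zero hd⟩).1
        have hkR : znorm k ≤ R := by
          refine (znorm_le_mul m.cast_nonneg fun i => ?_).trans hm
          have h := hk' i
          rw [abs_of_nonneg (by exact_mod_cast zero_le_one.trans h.1)]
          exact_mod_cast h.2
        rw [if_pos ⟨hk0, hkR⟩]
        exact Real.rpow_le_rpow_of_nonpos (one_pos.trans_le (one_le_znorm hk0)) hkR hr
    _ ≤ _ := (summable_truncated_rpow r hR).sum_le_tsum s fun k _ => truncated_rpow_nonneg r R k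

theorem mul_rpow_le_tsum_truncated_rpow {d N : ℕ} (hd : d ≠ 0) (hN : 1 ≤ N) {r : ℝ}
    (hr : r ≤ 0) :
    ((2 * d : ℝ) ^ d)⁻¹ * (N : ℝ) ^ (d + r) ≤
      ∑' k : Fin d → ℤ, if k ≠ 0 ∧ znorm k ≤ N then znorm k ^ r else 0 := by
  have hd' : (0 : ℝ) < d := by exact_mod_cast Nat.pos_of_ne_zero hd
  have hN' : (1 : ℝ) ≤ N := by exact_mod_cast hN
  have hfactor : ((2 * d : ℝ) ^ d)⁻¹ * (N : ℝ) ^ (d + r) =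
      (N / (2 * d) : ℝ) ^ d * (N : ℝ) ^ r := by
    rw [Real.rpow_add (by linarith), Real.rpow_natCast, div_pow]
    ring
  rw [hfactor]
  rcases lt_or_ge N d with h | h
  · refine le_trans ?_ (one_le_tsum_truncated_rpow hd r hN')
    have h' : (N : ℝ) ≤ d := by exact_mod_cast h.le
    refine mul_le_one₀ (pow_le_one₀ (by positivity) ?_) (by positivity)
      (Real.rpow_le_one_of_one_le_of_nonpos hN' hr)
    rw [div_le_one (by positivity)]
    linarith
  · refine le_trans ?_ (pow_mul_rpow_le_tsum_truncated_rpow (m := N / d) hd hr (by linarith)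
      (by exact_mod_cast Nat.mul_div_le N d))
    gcongr
    rw [div_le_iff₀ (by positivity)]
    have h1 : 1 ≤ N / d := (Nat.one_le_div_iff (Nat.pos_of_ne_zero hd)).mpr h
    have h2 : N ≤ (N / d) * (2 * d) := by
      have := Nat.div_add_mod N d
      have := Nat.mod_lt N (Nat.pos_of_ne_zero hd)
      nlinarith
    exact_mod_cast h2

/-- for `d ∈ {2,3}`, `γ ∈ (0, d/2)` and `q ∈ (0, min{1, 1/(d-2γ)})`,
one has `D_N ≤ C ε_N^q` for all `N ≥ 1`, with `C = C(d, γ, q)`. -/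
theorem stmt6 {d : ℕ} (hd : d = 2 ∨ d = 3) (γ : ℝ) (hγ : 0 < γ ∧ γ < d / 2)
    (q : ℝ) (hq : 0 < q ∧ q < min 1 (1 / ((d : ℝ) - 2 * γ))) :
    ∃ C : ℝ, 0 < C ∧ ∀ N : ℕ, 1 ≤ N → DN d γ N ≤ C * epsN d γ N ^ q := by
  have hd0 : d ≠ 0 := by omega
  have hd' : (0 : ℝ) < d := by exact_mod_cast Nat.pos_of_ne_zero hd0
  obtain ⟨hγ0, hγd⟩ := hγ
  obtain ⟨-, hq⟩ := hq
  obtain ⟨hq1, hqa⟩ := lt_min_iff.mp hq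
  have ha : 0 < (d : ℝ) - 2 * γ := by linarith
  rw [lt_div_iff₀ ha] at hqa
  set s : ℝ := -(d : ℝ) - 1 + q * (d - 2 * γ) with hs
  set K : ℝ := ∑' k : Fin d → ℤ, znorm k ^ s
  set c : ℝ := ((2 * d : ℝ) ^ d)⁻¹
  have hc : 0 < c := by positivity
  have hK : 0 ≤ K := tsum_nonneg fun k => Real.rpow_nonneg (znorm_nonneg k) s
  refine ⟨K / c ^ (1 - q) + 1, by positivity, fun N hN => ?_⟩
  have hN' : (1 : ℝ) ≤ N := by exact_mod_cast hN
  have hlower := mul_rpow_le_tsum_truncated_rpow hd0 hN (r := -(2 : ℝ) * γ) (by linarith)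
  have hupper := tsum_truncated_rpow_le (d := d) (r := -(2 : ℝ) * γ - 1) (s := s) (R := N)
    (by nlinarith) (by linarith) (by linarith)
  rw [DN, epsN]
  set S := ∑' k : Fin d → ℤ, if k ≠ 0 ∧ znorm k ≤ N then znorm k ^ (-(2 : ℝ) * γ) else 0
  set T := ∑' k : Fin d → ℤ, if k ≠ 0 ∧ znorm k ≤ N then znorm k ^ (-(2 : ℝ) * γ - 1) else 0
  have hS : 0 < S := lt_of_lt_of_le (by positivity) hlower
  have hpow : c ^ (1 - q) * (N : ℝ) ^ (-(2 : ℝ) * γ - 1 - s) ≤ S ^ (1 - q) := by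
    have hexp : -(2 : ℝ) * γ - 1 - s = (d + -(2 : ℝ) * γ) * (1 - q) := by rw [hs]; ring
    rw [hexp, Real.rpow_mul (by linarith), ← Real.mul_rpow hc.le (by positivity)]
    exact Real.rpow_le_rpow (by positivity) hlower (by linarith)
  have hT : T ≤ K / c ^ (1 - q) * S ^ (1 - q) := by
    calc T ≤ (N : ℝ) ^ (-(2 : ℝ) * γ - 1 - s) * K := hupper
      _ = K / c ^ (1 - q) * (c ^ (1 - q) * (N : ℝ) ^ (-(2 : ℝ) * γ - 1 - s)) := by
          field_simp
      _ ≤ K / c ^ (1 - q) * S ^ (1 - q) := by gcongr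
  have hSq : S⁻¹ ^ q = S⁻¹ * S ^ (1 - q) := by
    rw [Real.rpow_sub hS, Real.rpow_one, Real.inv_rpow hS.le]
    field_simp
  rw [hSq]
  calc S⁻¹ * T ≤ S⁻¹ * (K / c ^ (1 - q) * S ^ (1 - q)) := by gcongr
    _ = K / c ^ (1 - q) * (S⁻¹ * S ^ (1 - q)) := by ring
    _ ≤ (K / c ^ (1 - q) + 1) * (S⁻¹ * S ^ (1 - q)) := by
        gcongr
        linarith
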